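/- There exists a constant C > 0 such that for every finite connected graph G = (V,E), the hyperplane separation bound of the slack matrix S_G of the spanning tree polytope of G satisfies hsb(S_G) ≤ C · |E|. -/

import Mathlib

open scoped Classical
open Matrix BigOperators

/-- The Frobenius inner product of two real matrices. -/
def frob {m n : Type*} [Fintype m] [Fintype n] (A B : Matrix m n ℝ) : ℝ :=
  ∑ i, ∑ j, A i j * B i j

/-- The maximum absolute value of an entry of a real matrix. -/
noncomputable def mnorm {m n : Type*} [Fintype m] [Fintype n] (S : Matrix m n ℝ) : ℝ :=
  ⨆ p : m × n, |S p.1 p.2|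

/-- The finite set `R_{m,n}` of rank-one 0/1 matrices. -/
noncomputable def rankOne01 (m n : Type*) [Fintype m] [Fintype n] :
    Finset (Matrix m n ℝ) :=
  ((Finset.univ : Finset (Matrix m n Bool)).image
      (fun B => Matrix.of fun i j => if B i j then (1 : ℝ) else 0)).filter
    (fun R => R.rank = 1)

/-- The hyperplane separation bound
`hsb S = ‖S‖⁻¹ ⬝ sup { ⟨S,X⟩ : ⟨X,R⟩ ≤ 1 for all rank-one 0/1 matrices R }`. -/
noncomputable def hsb {m n : Type*} [Fintype m] [Fintype n] (S : Matrix m n ℝ) : ℝ :=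
  (mnorm S)⁻¹ *
    sSup {t : ℝ | ∃ X : Matrix m n ℝ,
      (∀ R ∈ rankOne01 m n, frob X R ≤ 1) ∧ t = frob S X}

/-- `T` is (the edge set of) a spanning tree of the graph `G`. -/
def IsSpanningTreeOf {V : Type*} (G : SimpleGraph V) (T : Finset (Sym2 V)) : Prop :=
  (↑T : Set (Sym2 V)) ⊆ G.edgeSet ∧ (SimpleGraph.fromEdgeSet (↑T : Set (Sym2 V))).IsTree

/-- `c(U,T)`: the number of connected components of the graph with vertex set `U` and
edge set `T ∩ E(U)` (the edges of `T` with both endpoints in `U`). -/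
noncomputable def numComponents {V : Type*} (T : Finset (Sym2 V)) (U : Finset V) : ℕ :=
  Nat.card
    ((SimpleGraph.fromEdgeSet (↑T : Set (Sym2 V))).induce (↑U : Set V)).ConnectedComponent

/-- The slack matrix `S_G` of the spanning tree polytope of `G` w.r.t. Edmonds'
description: columns are indexed by the spanning trees `T` of `G`, rows by the edges
(nonnegativity constraints, with entry `1` if `e ∈ T` and `0` otherwise) together with
the nonempty vertex subsets `U` (set constraints, with entry `c(U,T) - 1`). -/
noncomputable def stSlack {V : Type*} [Fintype V] (G : SimpleGraph V) :
    Matrix (↥G.edgeSet ⊕ {U : Finset V // U.Nonempty})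
      {T : Finset (Sym2 V) // IsSpanningTreeOf G T} ℝ :=
  Matrix.of fun r T =>
    Sum.elim
      (fun e : ↥G.edgeSet => if (e : Sym2 V) ∈ (T : Finset (Sym2 V)) then (1 : ℝ) else 0)
      (fun U : {U : Finset V // U.Nonempty} =>
        (numComponents (T : Finset (Sym2 V)) (U : Finset V) : ℝ) - 1) r

/-- If every edge of `K` joins a vertex to its image under a height-decreasing map `q`, then
the components of `K` correspond to the fixed points of `q`. -/
theorem card_connectedComponent_eq_card_fixedPoints {α : Type*} [Finite α] (K : SimpleGraph α)
    (q : α → α) (h : α → ℕ) (hq : ∀ a, q a = a ∨ h (q a) < h a)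
    (hadj : ∀ a b, K.Adj a b → q a = b ∨ q b = a) (hqadj : ∀ a, q a ≠ a → K.Adj a (q a)) :
    Nat.card K.ConnectedComponent = Nat.card {a // q a = a} := by
  have hfix : ∀ n a, h a ≤ n → q (q^[n] a) = q^[n] a := by
    intro n
    induction n with
    | zero =>
      intro a ha
      rcases hq a with h1 | h1
      · simpa using h1
      · omega
    | succ n ih =>
      intro a ha
      rcases hq a with h1 | h1
      · rw [Function.iterate_fixed h1, h1]
      · rw [Function.iterate_succ_apply]
        exact ih _ (by omega)
  obtain ⟨N, hN⟩ : ∃ N, ∀ a, h a ≤ N := by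
    obtain ⟨N, hN⟩ := (Set.finite_range h).bddAbove
    exact ⟨N, fun a => hN ⟨a, rfl⟩⟩
  have hstep : ∀ a, q^[N] (q a) = q^[N] a := fun a => by
    rw [← Function.iterate_succ_apply, Function.iterate_succ_apply', hfix N a (hN a)]
  have hinv : ∀ a b, K.Adj a b → q^[N] a = q^[N] b := by
    intro a b hab
    rcases hadj a b hab with rfl | rfl
    · exact (hstep a).symm
    · exact hstep b
  have hreach : ∀ n a, K.Reachable a (q^[n] a) := by
    intro n
    induction n with
    | zero => exact fun a => SimpleGraph.Reachable.refl a
    | succ n ih =>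
      intro a
      rw [Function.iterate_succ_apply]
      by_cases h1 : q a = a
      · rw [h1]
        exact ih a
      · exact (hqadj a h1).reachable.trans (ih (q a))
  refine (Nat.card_eq_of_bijective
    (fun a : {a // q a = a} => K.connectedComponentMk a.1) ⟨?_, ?_⟩).symm
  · rintro ⟨a, ha⟩ ⟨b, hb⟩ hab
    have hr : K.Reachable a b := SimpleGraph.ConnectedComponent.exact hab
    have key : q^[N] a = q^[N] b := by
      obtain ⟨p⟩ := hr
      clear hab ha hb
      induction p with
      | nil => rfl
      | cons hadj' _ ih => exact (hinv _ _ hadj').trans ih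
    rw [Function.iterate_fixed ha, Function.iterate_fixed hb] at key
    exact Subtype.ext key
  · intro c
    induction c using SimpleGraph.ConnectedComponent.ind with
    | h a =>
      exact ⟨⟨q^[N] a, hfix N a (hN a)⟩, SimpleGraph.ConnectedComponent.sound (hreach N a).symm⟩

/-- `w` is the parent of `v` in the tree `H` rooted at `r`. -/
def IsParent {V : Type*} (H : SimpleGraph V) (r v w : V) : Prop :=
  H.Adj v w ∧ H.dist r v = H.dist r w + 1

theorem IsParent.unique {V : Type*} {H : SimpleGraph V} (hH : H.IsTree) {r v w w' : V}
    (hw : IsParent H r v w) (hw' : IsParent H r v w') : w = w' := by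
  have path : ∀ {u}, IsParent H r v u → ∃ p : H.Walk r v, p.IsPath ∧ p.penultimate = u := by
    intro u hu
    obtain ⟨p, hp⟩ := hH.1.exists_walk_length_eq_dist r u
    refine ⟨p.concat hu.1.symm, ?_, by simp⟩
    apply SimpleGraph.Walk.isPath_of_length_eq_dist
    rw [SimpleGraph.Walk.length_concat, hp, hu.2]
  obtain ⟨p, hp, hpw⟩ := path hw
  obtain ⟨p', hp', hpw'⟩ := path hw'
  rw [← hpw, ← hpw', (hH.existsUnique_path r v).unique hp hp']

theorem exists_isParent {V : Type*} {H : SimpleGraph V} (hH : H.IsTree) {r v : V}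
    (hv : v ≠ r) : ∃ w, IsParent H r v w := by
  obtain ⟨p, hp⟩ := hH.1.exists_walk_length_eq_dist r v
  have hnil : ¬ p.Nil := fun h => hv h.eq.symm
  have hadj := p.adj_penultimate hnil
  refine ⟨p.penultimate, hadj.symm, ?_⟩
  have h1 := SimpleGraph.dist_le p.dropLast
  have h2 := hH.1.dist_triangle (u := r) (v := p.penultimate) (w := v)
  rw [SimpleGraph.dist_eq_one_iff_adj.2 hadj] at h2
  have h3 : p.dropLast.length + 1 = p.length := by
    rw [SimpleGraph.Walk.length_dropLast_add_one hnil]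
  omega

theorem isParent_or_isParent {V : Type*} {H : SimpleGraph V} (hH : H.IsTree) (r : V) {v w : V}
    (h : H.Adj v w) : IsParent H r v w ∨ IsParent H r w v := by
  rcases hH.dist_eq_dist_add_one_of_adj r h with h1 | h1
  · exact Or.inl ⟨h, h1⟩
  · exact Or.inr ⟨h.symm, h1⟩

theorem card_connectedComponent_induce {V : Type*} [Fintype V] {H : SimpleGraph V}
    (hH : H.IsTree) {r : V} {U : Finset V} (hr : r ∈ U) :
    Nat.card (H.induce (↑U : Set V)).ConnectedComponent =
      (U.filter fun v => ∃ w, w ∉ U ∧ IsParent H r v w).card + 1 := by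
  let q : (↑U : Set V) → (↑U : Set V) := fun v =>
    if h : ∃ w : (↑U : Set V), IsParent H r v w then h.choose else v
  have hq1 : ∀ v w : (↑U : Set V), IsParent H r v w → q v = w := by
    intro v w hvw
    have h : ∃ w : (↑U : Set V), IsParent H r v w := ⟨w, hvw⟩
    simp only [q, dif_pos h]
    exact Subtype.ext (h.choose_spec.unique hH hvw)
  have hq2 : ∀ v, q v ≠ v → IsParent H r v (q v) := by
    intro v hv
    by_cases h : ∃ w : (↑U : Set V), IsParent H r v w
    · obtain ⟨w, hw⟩ := h
      rwa [hq1 v w hw]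
    · exact absurd (dif_neg h) hv
  have hfix : ∀ v : (↑U : Set V), q v = v ↔ v.1 = r ∨ ∃ w, w ∉ U ∧ IsParent H r v w := by
    intro v
    constructor
    · intro hv
      by_contra! hcon
      obtain ⟨w, hw⟩ := exists_isParent hH hcon.1
      have hwU : w ∈ U := by
        by_contra hwU
        exact hcon.2 w hwU hw
      have h1 := hq1 v ⟨w, hwU⟩ hw
      rw [hv] at h1
      subst h1
      exact hw.1.ne rfl
    · intro h
      by_contra hne
      have hp := hq2 v hne
      rcases h with h | ⟨w, hwU, hw⟩
      · have := hp.2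
        simp [h] at this
      · exact hwU (hw.unique hH hp ▸ (q v).2)
  rw [card_connectedComponent_eq_card_fixedPoints _ q (fun v => H.dist r v)]
  · have hnot : r ∉ U.filter fun v => ∃ w, w ∉ U ∧ IsParent H r v w := by
      intro h
      obtain ⟨w, -, -, hw⟩ := (Finset.mem_filter.1 h).2
      simp at hw
    rw [← Finset.card_insert_of_notMem hnot, ← Nat.card_eq_finsetCard]
    refine Nat.card_congr ⟨fun v => ⟨v.1.1, ?_⟩, fun v => ⟨⟨v.1, ?_⟩, ?_⟩,
      fun _ => rfl, fun _ => rfl⟩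
    · exact Finset.mem_insert.2 (((hfix v.1).1 v.2).imp_right
        fun h => Finset.mem_filter.2 ⟨v.1.2, h⟩)
    · rcases Finset.mem_insert.1 v.2 with h | h
      · rwa [Finset.mem_coe, h]
      · exact (Finset.mem_filter.1 h).1
    · refine (hfix _).2 ?_
      rcases Finset.mem_insert.1 v.2 with h | h
      · exact Or.inl h
      · exact Or.inr (Finset.mem_filter.1 h).2
  · intro a
    by_cases h : q a = a
    · exact Or.inl h
    · right
      have := (hq2 a h).2
      omega
  · intro a b hab
    rcases isParent_or_isParent hH r (SimpleGraph.induce_adj.1 hab) with h | h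
    · exact Or.inl (hq1 _ _ h)
    · exact Or.inr (hq1 _ _ h)
  · intro a ha
    exact SimpleGraph.induce_adj.2 (hq2 a ha).1

/-- The 0/1 indicator matrix of the combinatorial rectangle `A × B`. -/
noncomputable def rect {m n : Type*} (A : m → Prop) (B : n → Prop) : Matrix m n ℝ :=
  Matrix.of fun i j => if A i ∧ B j then 1 else 0

theorem rect_mem_rankOne01 {m n : Type*} [Fintype m] [Fintype n] {A : m → Prop} {B : n → Prop}
    (hA : ∃ i, A i) (hB : ∃ j, B j) : rect A B ∈ rankOne01 m n := by
  refine Finset.mem_filter.2 ⟨Finset.mem_image.2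
    ⟨Matrix.of fun i j => decide (A i ∧ B j), Finset.mem_univ _, ?_⟩, le_antisymm ?_ ?_⟩
  · ext i j
    simp [rect]
  · have h : rect A B =
        vecMulVec (fun i => if A i then (1 : ℝ) else 0) (fun j => if B j then 1 else 0) := by
      ext i j
      simp [rect, vecMulVec_apply, ← ite_and, and_comm]
    rw [h]
    exact rank_vecMulVec_le _ _
  · obtain ⟨i, hi⟩ := hA
    obtain ⟨j, hj⟩ := hB
    rw [Nat.one_le_iff_ne_zero]
    intro h0
    rw [Matrix.rank, Submodule.finrank_eq_zero, LinearMap.range_eq_bot] at h0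
    have := congrFun (LinearMap.congr_fun h0 (Pi.single j 1)) i
    simp [rect, hi, hj] at this

theorem frob_rect_le_one {m n : Type*} [Fintype m] [Fintype n] {X : Matrix m n ℝ}
    (hX : ∀ R ∈ rankOne01 m n, frob X R ≤ 1) (A : m → Prop) (B : n → Prop) :
    frob X (rect A B) ≤ 1 := by
  by_cases hA : ∃ i, A i
  · by_cases hB : ∃ j, B j
    · exact hX _ (rect_mem_rankOne01 hA hB)
    · push Not at hB
      simp [frob, rect, hB]
  · push Not at hA
    simp [frob, rect, hA]

/-- A partition of `S` into rectangles indexed by `K` bounds the hyperplane separation bound. -/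
theorem hsb_le_of_eq_sum_rect {m n K : Type*} [Fintype m] [Fintype n] [Fintype K]
    (S : Matrix m n ℝ) (A : K → m → Prop) (B : K → n → Prop)
    (hS : S = ∑ k, rect (A k) (B k)) :
    hsb S ≤ (mnorm S)⁻¹ * Fintype.card K := by
  refine mul_le_mul_of_nonneg_left ?_
    (inv_nonneg.2 (Real.iSup_nonneg fun _ => abs_nonneg _))
  refine Real.sSup_le ?_ (Nat.cast_nonneg _)
  rintro t ⟨X, hX, rfl⟩
  have h : frob S X = ∑ k, frob X (rect (A k) (B k)) := by
    simp only [frob, hS, Matrix.sum_apply, Finset.sum_mul]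
    rw [Finset.sum_comm (s := (Finset.univ : Finset K))]
    refine Finset.sum_congr rfl fun i _ => ?_
    rw [Finset.sum_comm]
    simp only [mul_comm]
  rw [h]
  calc ∑ k, frob X (rect (A k) (B k)) ≤ ∑ _k : K, (1 : ℝ) :=
        Finset.sum_le_sum fun k _ => frob_rect_le_one hX _ _
    _ = Fintype.card K := by simp

theorem abs_le_mnorm {m n : Type*} [Fintype m] [Fintype n] (S : Matrix m n ℝ) (i : m) (j : n) :
    |S i j| ≤ mnorm S :=
  le_ciSup (f := fun p : m × n => |S p.1 p.2|) (Set.finite_range _).bddAbove (i, j)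

theorem stSlack_inr_eq {V : Type*} [Fintype V] (G : SimpleGraph V)
    {U : {U : Finset V // U.Nonempty}} {T : {T : Finset (Sym2 V) // IsSpanningTreeOf G T}}
    {r : V} (hr : r ∈ U.1) :
    stSlack G (Sum.inr U) T = (Finset.univ.filter fun d : G.Dart => (d.fst ∈ U.1 ∧ d.snd ∉ U.1) ∧
      IsParent (SimpleGraph.fromEdgeSet (T.1 : Set (Sym2 V))) r d.fst d.snd).card := by
  obtain ⟨hsub, hT⟩ := T.2
  simp only [stSlack, Matrix.of_apply, Sum.elim_inr, numComponents]
  rw [card_connectedComponent_induce hT hr]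
  push_cast
  rw [add_sub_cancel_right, Nat.cast_inj]
  symm
  refine Finset.card_bij (fun d _ => d.fst) ?_ ?_ ?_
  · intro d hd
    simp only [Finset.mem_filter, Finset.mem_univ, true_and] at hd
    exact Finset.mem_filter.2 ⟨hd.1.1, d.snd, hd.1.2, hd.2⟩
  · intro d hd d' hd' heq
    simp only [Finset.mem_filter, Finset.mem_univ, true_and] at hd hd'
    have h2 := hd'.2
    rw [← heq] at h2
    exact SimpleGraph.Dart.ext _ _ (Prod.ext heq (hd.2.unique hT h2))
  · intro v hv
    obtain ⟨hvU, w, hwU, hw⟩ := Finset.mem_filter.1 hv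
    have hG : G.Adj v w := hsub ((SimpleGraph.fromEdgeSet_adj _).1 hw.1).1
    exact ⟨⟨(v, w), hG⟩, by simpa using ⟨⟨hvU, hwU⟩, hw⟩, rfl⟩

theorem hsb_stSlack_le_card {V : Type*} [Fintype V] (G : SimpleGraph V) :
    hsb (stSlack G) ≤ (mnorm (stSlack G))⁻¹ *
      (G.edgeSet.ncard + Fintype.card V * (2 * G.edgeSet.ncard) : ℝ) := by
  let A : G.edgeSet ⊕ (V × G.Dart) → G.edgeSet ⊕ {U : Finset V // U.Nonempty} → Prop :=
    Sum.elim (fun e i => i = Sum.inl e) fun k i => Sum.elim (fun _ => False)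
      (fun U => U.2.choose = k.1 ∧ k.2.fst ∈ U.1 ∧ k.2.snd ∉ U.1) i
  let B : G.edgeSet ⊕ (V × G.Dart) → {T : Finset (Sym2 V) // IsSpanningTreeOf G T} → Prop :=
    Sum.elim (fun e T => e.1 ∈ T.1) fun k T =>
      IsParent (SimpleGraph.fromEdgeSet (T.1 : Set (Sym2 V))) k.1 k.2.fst k.2.snd
  have key := hsb_le_of_eq_sum_rect (stSlack G) A B ?_
  · refine key.trans_eq ?_
    rw [Fintype.card_sum, Fintype.card_prod, SimpleGraph.dart_card_eq_twice_card_edges,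
      SimpleGraph.edgeFinset_card, ← Nat.card_coe_set_eq, Nat.card_eq_fintype_card]
    push_cast
    ring
  · ext i T
    rw [Matrix.sum_apply, Fintype.sum_sum_type, Fintype.sum_prod_type]
    rcases i with e | U
    · simp [A, B, rect, stSlack, ite_and]
    · rw [stSlack_inr_eq G U.2.choose_spec, Finset.card_filter]
      simp [A, B, rect, and_assoc, ite_and]

theorem card_le_mnorm_stSlack {V : Type*} [Fintype V] {G : SimpleGraph V} (hG : G.Connected) :
    (Fintype.card V : ℝ) ≤ 2 * (mnorm (stSlack G) + 1) := by
  obtain ⟨H, hHG, hH⟩ := hG.exists_isTree_le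
  have hedge : SimpleGraph.fromEdgeSet (↑H.edgeFinset : Set (Sym2 V)) = H := by simp
  let T : {T : Finset (Sym2 V) // IsSpanningTreeOf G T} := ⟨H.edgeFinset, by
    simpa using SimpleGraph.edgeSet_mono hHG, by rwa [hedge]⟩
  obtain ⟨c⟩ := hH.colorable_two
  have indep : ∀ k, ((Finset.univ.filter fun v => c v = k).card : ℝ) ≤ mnorm (stSlack G) + 1 := by
    intro k
    set U := Finset.univ.filter fun v => c v = k with hU
    rcases U.eq_empty_or_nonempty with h | h
    · rw [h]
      have := Real.iSup_nonneg fun p : _ × _ => abs_nonneg (stSlack G p.1 p.2)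
      simp only [Finset.card_empty, Nat.cast_zero]
      exact add_nonneg this zero_le_one
    · have hle := (le_abs_self _).trans (abs_le_mnorm (stSlack G) (Sum.inr ⟨U, h⟩) T)
      have hbot : H.induce (↑U : Set V) = ⊥ := by
        ext a b
        have ha := a.2
        have hb := b.2
        simp only [hU, Finset.coe_filter, Finset.mem_univ, true_and, Set.mem_ofPred_eq] at ha hb
        simp only [SimpleGraph.bot_adj, iff_false]
        exact fun hab => c.valid (SimpleGraph.induce_adj.1 hab) (ha.trans hb.symm)
      have hcard : Nat.card (H.induce (↑U : Set V)).ConnectedComponent = U.card := by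
        rw [card_connectedComponent_eq_card_fixedPoints _ id (fun _ => 0)] <;> simp [hbot]
      have hS : stSlack G (Sum.inr ⟨U, h⟩) T = U.card - 1 := by
        simp only [stSlack, Matrix.of_apply, Sum.elim_inr, numComponents, T]
        rw [hedge, hcard]
      linarith
  have hsum : (Fintype.card V : ℝ) =
      ∑ k : Fin 2, ((Finset.univ.filter fun v => c v = k).card : ℝ) := by
    rw [← Finset.card_univ, Finset.card_eq_sum_card_fiberwise (f := c) (t := Finset.univ)
      (by simp)]
    push_cast
    rfl
  rw [hsum, Fin.sum_univ_two]
  linarith [indep 0, indep 1]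

theorem one_le_mnorm_stSlack {V : Type*} [Fintype V] {G : SimpleGraph V} (hG : G.Connected)
    (hcard : 1 < Fintype.card V) : 1 ≤ mnorm (stSlack G) := by
  obtain ⟨H, hHG, hH⟩ := hG.exists_isTree_le
  have hedge : SimpleGraph.fromEdgeSet (↑H.edgeFinset : Set (Sym2 V)) = H := by simp
  let T : {T : Finset (Sym2 V) // IsSpanningTreeOf G T} := ⟨H.edgeFinset, by
    simpa using SimpleGraph.edgeSet_mono hHG, by rwa [hedge]⟩
  have := Fintype.one_lt_card_iff_nontrivial.1 hcard
  obtain ⟨v⟩ := hG.nonempty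
  obtain ⟨w, hw⟩ := hH.1.preconnected.exists_adj_of_nontrivial v
  have hle := (le_abs_self _).trans
    (abs_le_mnorm (stSlack G) (Sum.inl ⟨s(v, w), hHG hw⟩) T)
  simpa [stSlack, T, hw] using hle

/-- There is a constant `C > 0` such that for every finite connected graph `G = (V,E)`,
the hyperplane separation bound of the slack matrix of the spanning tree polytope of `G`
is at most `C ⬝ |E|`. -/
theorem hsb_stSlack_le : ∃ C : ℝ, 0 < C ∧
    ∀ (V : Type) [Fintype V] (G : SimpleGraph V), G.Connected →
      hsb (stSlack G) ≤ C * G.edgeSet.ncard := by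
  refine ⟨9, by norm_num, fun V _ G hG => ?_⟩
  refine (hsb_stSlack_le_card G).trans ?_
  have hn := card_le_mnorm_stSlack hG
  have hE : (0 : ℝ) ≤ G.edgeSet.ncard := Nat.cast_nonneg _
  rcases le_or_gt (Fintype.card V) 1 with h1 | h1
  · have := Fintype.card_le_one_iff_subsingleton.1 h1
    have hE0 : G.edgeSet = ∅ := by
      rw [SimpleGraph.edgeSet_eq_empty]
      exact Subsingleton.elim _ _
    simp [hE0]
  · have hm := one_le_mnorm_stSlack hG h1
    rw [inv_mul_le_iff₀ (by linarith)]
    nlinarith [mul_le_mul_of_nonneg_right hn hE, mul_le_mul_of_nonneg_right hm hE]
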